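/- Let 0 < α < 1, λ > 0, and let f ∈ L¹_{ψ,ω}(ℝ). Define the stress response σ(t) := (1/ω(t)) ∫_{-∞}^t (ψ(t) − ψ(τ))^{α−1} E_{α,α}(−λ (ψ(t) − ψ(τ))^α) f(τ) ω(τ) ψ'(τ) dτ. Then σ ∈ L¹_{ψ,ω}(ℝ) and its weighted Fourier transform satisfies, for every ξ ∈ ℝ, σ̂_{ψ,ω}(ξ) = f̂_{ψ,ω}(ξ) / ((iξ)^α + λ), where (iξ)^α is the principal branch; i.e. σ is the weighted convolution of the aging Green's function 𝒢(t) = ω(t)^{-1} ψ(t)^{α−1} E_{α,α}(−λ ψ(t)^α) Θ(ψ(t)) with f, and solves the Kelvin–Voigt equation in the frequency domain. -/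

import Mathlib

open MeasureTheory Set Filter

noncomputable section

/-- The symmetric weighted Fourier transform. -/
def wFT (ψ ψ' ω : ℝ → ℝ) (f : ℝ → ℂ) (ξ : ℝ) : ℂ :=
  (Real.sqrt (2 * Real.pi) : ℂ)⁻¹ *
    ∫ t : ℝ, f t * Complex.exp (-(Complex.I * (ξ : ℂ) * (ψ t : ℂ))) * ((ω t * ψ' t : ℝ) : ℂ)

/-- The two-parameter Mittag-Leffler function (real argument). -/
def mlE (α β x : ℝ) : ℝ := ∑' k : ℕ, x ^ k / Real.Gamma (α * k + β)

/-- The stress response: weighted convolution of the aging Green's function with `f`. -/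
def sigmaSol (α lam : ℝ) (ψ ψ' ω : ℝ → ℝ) (f : ℝ → ℂ) (t : ℝ) : ℂ :=
  ((ω t : ℝ) : ℂ)⁻¹ *
    ∫ τ in Set.Iio t,
      (((ψ t - ψ τ) ^ (α - 1) * mlE α α (-(lam * (ψ t - ψ τ) ^ α)) * (ω τ * ψ' τ) : ℝ) : ℂ) * f τ

open scoped Topology

lemma integral_rpow_mul_sub_rpow {s t a : ℝ} (hs : 0 < s) (ht : 0 < t) (ha : 0 < a) :
    ∫ x in (0 : ℝ)..a, x ^ (s - 1) * (a - x) ^ (t - 1) =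
      a ^ (s + t - 1) * (Real.Gamma s * Real.Gamma t / Real.Gamma (s + t)) := by
  have h := Complex.betaIntegral_scaled (s : ℂ) (t : ℂ) ha
  rw [Complex.betaIntegral_eq_Gamma_mul_div _ _ (by simpa using hs) (by simpa using ht)] at h
  have h2 : ∫ x in (0 : ℝ)..a, (x : ℂ) ^ ((s : ℂ) - 1) * ((a : ℂ) - x) ^ ((t : ℂ) - 1) =
      ((∫ x in (0 : ℝ)..a, x ^ (s - 1) * (a - x) ^ (t - 1) : ℝ) : ℂ) := by
    rw [← intervalIntegral.integral_ofReal]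
    refine intervalIntegral.integral_congr fun x hx => ?_
    rw [uIcc_of_le ha.le] at hx
    have h1 : (0 : ℝ) ≤ a - x := sub_nonneg.2 hx.2
    rw [Complex.ofReal_mul, Complex.ofReal_cpow hx.1, Complex.ofReal_cpow h1]
    push_cast
    rfl
  rw [h2, ← Complex.ofReal_add, Complex.Gamma_ofReal, Complex.Gamma_ofReal, Complex.Gamma_ofReal,
    ← Complex.ofReal_one, ← Complex.ofReal_sub, ← Complex.ofReal_cpow ha.le] at h
  exact_mod_cast h

lemma intervalIntegrable_rpow_mul_sub_rpow {s t a : ℝ} (hs : 0 < s) (ht : 0 < t) (ha : 0 < a) :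
    IntervalIntegrable (fun x : ℝ => x ^ (s - 1) * (a - x) ^ (t - 1)) volume 0 a := by
  by_contra h
  have h1 := integral_rpow_mul_sub_rpow hs ht ha
  rw [intervalIntegral.integral_undef h] at h1
  have := Real.Gamma_pos_of_pos hs
  have := Real.Gamma_pos_of_pos ht
  have := Real.Gamma_pos_of_pos (add_pos hs ht)
  have : 0 < a ^ (s + t - 1) * (Real.Gamma s * Real.Gamma t / Real.Gamma (s + t)) := by positivity
  exact this.ne h1

lemma rpow_mul_exp_neg_le_Gamma {R x : ℝ} (hR : 0 < R) (hx : 1 ≤ x) :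
    R ^ (x - 1) * Real.exp (-R) ≤ Real.Gamma x := by
  rw [Real.Gamma_eq_integral (by linarith), ← integral_exp_neg_Ioi R, ← integral_const_mul]
  have hInt := Real.GammaIntegral_convergent (show 0 < x by linarith)
  refine (setIntegral_mono_on ((integrableOn_exp_neg_Ioi R).const_mul _)
    (hInt.mono_set (Ioi_subset_Ioi hR.le)) measurableSet_Ioi fun t ht => ?_).trans
    (setIntegral_mono_set hInt ?_ (Ioi_subset_Ioi hR.le).eventuallyLE)
  · rw [mul_comm]
    exact mul_le_mul_of_nonneg_left
      (Real.rpow_le_rpow hR.le (le_of_lt ht) (by linarith)) (Real.exp_pos _).le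
  · filter_upwards [ae_restrict_mem measurableSet_Ioi] with t ht
    have : (0 : ℝ) < t := ht
    simp only [Pi.zero_apply]
    positivity

lemma summable_mittagLeffler {α β : ℝ} (hα : 0 < α) (x : ℝ) :
    Summable fun k : ℕ => x ^ k / Real.Gamma (α * k + β) := by
  set R : ℝ := (2 * |x| + 1) ^ α⁻¹ with hR
  have hx := abs_nonneg x
  have hR0 : 0 < R := by positivity
  have hRα : R ^ α = 2 * |x| + 1 := by
    rw [hR, ← Real.rpow_mul (by positivity), inv_mul_cancel₀ hα.ne', Real.rpow_one]
  have hsum : Summable fun k : ℕ => Real.exp R * R ^ (1 - β) * (|x| / (2 * |x| + 1)) ^ k := by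
    refine (summable_geometric_of_lt_one (by positivity) ?_).mul_left _
    rw [div_lt_one (by positivity)]
    linarith
  refine hsum.of_norm_bounded_eventually_nat ?_
  have hlim : Tendsto (fun k : ℕ => α * k + β) atTop atTop :=
    tendsto_atTop_add_const_right _ _ (tendsto_natCast_atTop_atTop.const_mul_atTop hα)
  filter_upwards [hlim.eventually_ge_atTop 1] with k hk
  have hΓ := rpow_mul_exp_neg_le_Gamma hR0 hk
  have hΓ0 : 0 < Real.Gamma (α * k + β) := Real.Gamma_pos_of_pos (by linarith)
  rw [norm_div, norm_pow, Real.norm_eq_abs, Real.norm_of_nonneg hΓ0.le, div_le_iff₀ hΓ0]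
  have hpow : R ^ (α * k + β - 1) = (2 * |x| + 1) ^ k * (R ^ (1 - β))⁻¹ := by
    rw [show α * k + β - 1 = α * k + -(1 - β) by ring, Real.rpow_add hR0, Real.rpow_mul hR0.le,
      hRα, Real.rpow_natCast, Real.rpow_neg hR0.le]
  rw [hpow, Real.exp_neg] at hΓ
  refine le_trans (le_of_eq ?_) (mul_le_mul_of_nonneg_left hΓ (by positivity))
  have : R ^ (1 - β) ≠ 0 := by positivity
  rw [div_pow]
  field_simp

lemma continuous_mlE {α β : ℝ} (hα : 0 < α) : Continuous (mlE α β) := by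
  refine continuous_iff_continuousAt.2 fun x => ?_
  have hs := (summable_mittagLeffler (β := β) hα (|x| + 1)).norm
  have hcont : ContinuousOn (mlE α β) (Icc (-(|x| + 1)) (|x| + 1)) := by
    refine continuousOn_tsum (fun k => by fun_prop) hs fun k y hy => ?_
    rw [norm_div, norm_div, norm_pow, norm_pow]
    gcongr
    rw [Real.norm_eq_abs, Real.norm_eq_abs]
    exact (abs_le.2 hy).trans (le_abs_self _)
  exact hcont.continuousAt (Icc_mem_nhds (by linarith [neg_abs_le x]) (by linarith [le_abs_self x]))

/-- The Green's function of the fractional Kelvin–Voigt equation with respect to operational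
time. -/
def kvKernel (α lam s : ℝ) : ℝ := s ^ (α - 1) * mlE α α (-(lam * s ^ α))

lemma continuous_mlE_rpow {α : ℝ} (lam : ℝ) (hα : 0 < α) :
    Continuous fun s : ℝ => mlE α α (-(lam * s ^ α)) :=
  (continuous_mlE hα).comp (by fun_prop (disch := exact hα.le))

lemma intervalIntegrable_kvKernel {α : ℝ} (lam : ℝ) (hα : 0 < α) (a b : ℝ) :
    IntervalIntegrable (kvKernel α lam) volume a b :=
  (intervalIntegral.intervalIntegrable_rpow' (by linarith)).mul_continuousOn
    (continuous_mlE_rpow lam hα).continuousOn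

lemma intervalIntegrable_abel_kvKernel {α a : ℝ} (lam : ℝ) (hα : 0 < α) (ha : 0 < a) :
    IntervalIntegrable (fun u => (a - u) ^ (α - 1) * kvKernel α lam u) volume 0 a := by
  refine ((intervalIntegrable_rpow_mul_sub_rpow hα hα ha).mul_continuousOn
    (continuous_mlE_rpow lam hα).continuousOn).congr fun u _ => ?_
  simp only [kvKernel]
  ring

lemma hasSum_kvKernel {α lam s : ℝ} (hα : 0 < α) (hs : 0 < s) :
    HasSum (fun k : ℕ => (-lam) ^ k * s ^ (α * (k + 1) - 1) / Real.Gamma (α * (k + 1)))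
      (kvKernel α lam s) := by
  refine (((summable_mittagLeffler (β := α) hα (-(lam * s ^ α))).hasSum).mul_left
    (s ^ (α - 1))).congr_fun ?_
  intro k
  have h : s ^ (α * (k + 1) - 1) = s ^ (α - 1) * (s ^ α) ^ k := by
    rw [← Real.rpow_natCast, ← Real.rpow_mul hs.le, ← Real.rpow_add hs]
    ring_nf
  rw [h, neg_mul_eq_neg_mul, mul_pow, mul_add_one]
  ring

/-- The convolution equation `Γ(α) k + λ (u ^ (α - 1) * k) = s ^ (α - 1)` for the kernel `k`. -/
lemma kvKernel_volterra {α lam s : ℝ} (hα : 0 < α) (hlam : 0 < lam) (hs : 0 < s) :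
    lam * ∫ u in (0 : ℝ)..s, (s - u) ^ (α - 1) * kvKernel α lam u =
      s ^ (α - 1) - Real.Gamma α * kvKernel α lam s := by
  have hΓ := Real.Gamma_pos_of_pos hα
  set a : ℕ → ℝ := fun k => (-lam) ^ k * s ^ (α * (k + 1) - 1) / Real.Gamma (α * (k + 1)) with ha
  have hsum : HasSum a (kvKernel α lam s) := hasSum_kvKernel hα hs
  have hshift : HasSum (fun k => a (k + 1)) (kvKernel α lam s - a 0) := by
    simpa using (hasSum_nat_add_iff' 1).2 hsum
  have hexp : ∀ k : ℕ, 0 < α * ((k : ℝ) + 1) := fun k => by positivity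
  set c : ℕ → ℝ := fun k => (-lam) ^ k / Real.Gamma (α * (k + 1)) with hc
  set F : ℕ → ℝ → ℝ := fun k u => c k * (u ^ (α * (k + 1) - 1) * (s - u) ^ (α - 1)) with hF
  have hFint : ∀ k, IntegrableOn (F k) (Ioc 0 s) := fun k =>
    (((intervalIntegrable_rpow_mul_sub_rpow (hexp k) hα hs).1).const_mul _)
  have hB : ∀ k : ℕ, ∫ u in Ioc 0 s, u ^ (α * (k + 1) - 1) * (s - u) ^ (α - 1) =
      s ^ (α * (k + 1) + α - 1) *
        (Real.Gamma (α * (k + 1)) * Real.Gamma α / Real.Gamma (α * (k + 1) + α)) := fun k => by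
    rw [← intervalIntegral.integral_of_le hs.le, integral_rpow_mul_sub_rpow (hexp k) hα hs]
  have hval : ∀ k, ∫ u in Ioc 0 s, F k u = -(Real.Gamma α / lam) * a (k + 1) := fun k => by
    have h1 := (Real.Gamma_pos_of_pos (hexp k)).ne'
    have h2 : α * (((k + 1 : ℕ) : ℝ) + 1) = α * (k + 1) + α := by push_cast; ring
    simp only [hF, hc, ha]
    rw [integral_const_mul, hB k, h2, pow_succ]
    field_simp
  have hnorm : ∀ k, ∫ u in Ioc 0 s, ‖F k u‖ = ‖∫ u in Ioc 0 s, F k u‖ := fun k => by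
    have h0 : ∀ u ∈ Ioc 0 s, 0 ≤ u ^ (α * (k + 1) - 1) * (s - u) ^ (α - 1) := fun u hu =>
      mul_nonneg (Real.rpow_nonneg hu.1.le _) (Real.rpow_nonneg (sub_nonneg.2 hu.2) _)
    simp only [hF]
    rw [integral_const_mul, norm_mul,
      Real.norm_of_nonneg (setIntegral_nonneg measurableSet_Ioc h0), ← integral_const_mul]
    refine setIntegral_congr_fun measurableSet_Ioc fun u hu => ?_
    rw [norm_mul, Real.norm_of_nonneg (h0 u hu)]
  have hFsum : Summable fun k => ∫ u in Ioc 0 s, ‖F k u‖ := by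
    simp only [hnorm, hval]
    exact (hshift.summable.mul_left _).norm
  have hmain := hasSum_integral_of_summable_integral_norm hFint hFsum
  simp only [hval] at hmain
  have hpt : ∫ u in Ioc 0 s, ∑' k, F k u = ∫ u in (0 : ℝ)..s, (s - u) ^ (α - 1) * kvKernel α lam u := by
    rw [intervalIntegral.integral_of_le hs.le]
    refine setIntegral_congr_fun measurableSet_Ioc fun u hu => ?_
    refine (((hasSum_kvKernel (lam := lam) hα hu.1).mul_left ((s - u) ^ (α - 1))).congr_fun
      fun k => ?_).tsum_eq
    simp only [hF, hc]
    ring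
  rw [hpt] at hmain
  rw [hmain.unique (hshift.mul_left _)]
  simp only [ha]
  field_simp
  simp only [CharP.cast_eq_zero, zero_add, mul_one]
  ring

lemma mlE_zero (α β : ℝ) : mlE α β 0 = (Real.Gamma β)⁻¹ := by
  rw [mlE, tsum_eq_single 0 fun k hk => by simp [hk]]
  simp

/-- The kernel is positive: up to a first point `s₀` where it is not, the convolution equation at
earlier points `s` bounds the convolution at `s₀` too well, because
`(s₀ - u) ^ (α - 1) ≤ (s₀ / s) ^ (α - 1) * (s - u) ^ (α - 1)` for `0 ≤ u < s < s₀`. -/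
lemma kvKernel_pos {α lam s : ℝ} (hα : 0 < α) (hα1 : α < 1) (hlam : 0 < lam) (hs : 0 < s) :
    0 < kvKernel α lam s := by
  have hΓ := Real.Gamma_pos_of_pos hα
  have hm := continuous_mlE_rpow lam hα
  have hiff : ∀ {u : ℝ}, 0 < u → (0 < kvKernel α lam u ↔ 0 < mlE α α (-(lam * u ^ α))) :=
    fun hu => mul_pos_iff_of_pos_left (Real.rpow_pos_of_pos hu _)
  by_contra hneg
  rw [hiff hs, not_lt] at hneg
  set S : Set ℝ := Ici 0 ∩ {u | mlE α α (-(lam * u ^ α)) ≤ 0} with hS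
  have hScl : IsClosed S := isClosed_Ici.inter (isClosed_le hm continuous_const)
  have hSne : S.Nonempty := ⟨s, hs.le, hneg⟩
  have hSbd : BddBelow S := ⟨0, fun u hu => hu.1⟩
  have hs₀S := hScl.csInf_mem hSne hSbd
  set s₀ := sInf S with hs₀
  have hs₀pos : 0 < s₀ := by
    refine lt_of_le_of_ne hs₀S.1 fun h => ?_
    have h2 : mlE α α (-(lam * s₀ ^ α)) ≤ 0 := hs₀S.2
    rw [← h, Real.zero_rpow hα.ne', mul_zero, neg_zero, mlE_zero] at h2
    exact absurd (inv_pos.2 hΓ) h2.not_gt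
  have hk₀ : kvKernel α lam s₀ ≤ 0 := by
    rw [← not_lt, hiff hs₀pos, not_lt]
    exact hs₀S.2
  have hkpos : ∀ u, 0 < u → u < s₀ → 0 < kvKernel α lam u := fun u hu hus => by
    rw [hiff hu]
    by_contra h
    exact (csInf_le hSbd ⟨hu.le, not_lt.1 h⟩).not_gt hus
  have hlim : ContinuousAt
      (fun u => (s₀ / u) ^ (α - 1) * Real.Gamma α - lam * ((s₀ - u) ^ α / α)) s₀ := by
    refine ContinuousAt.sub (ContinuousAt.mul (ContinuousAt.rpow_const ?_ ?_) continuousAt_const)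
      (continuousAt_const.mul (ContinuousAt.div_const (ContinuousAt.rpow_const ?_ ?_) _))
    · exact continuousAt_const.div continuousAt_id hs₀pos.ne'
    · left
      rw [div_self hs₀pos.ne']
      exact one_ne_zero
    · fun_prop
    · exact Or.inr hα.le
  have hev := hlim.eventually (lt_mem_nhds (a := 0) (by
    beta_reduce
    rw [div_self hs₀pos.ne', Real.one_rpow, sub_self, Real.zero_rpow hα.ne']
    simpa using hΓ))
  obtain ⟨l, r, hlr, hsub⟩ := mem_nhds_iff_exists_Ioo_subset.1 (hev.and (lt_mem_nhds hs₀pos))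
  obtain ⟨s₁, hls₁, hs₁⟩ := exists_between hlr.1
  have hpos₁ : ∀ u ∈ Icc s₁ s₀, 0 < u := fun u hu =>
    (hsub ⟨hls₁.trans_le hu.1, hu.2.trans_lt hlr.2⟩).2
  have hcont : ContinuousOn (kvKernel α lam) (Icc s₁ s₀) := by
    refine ContinuousOn.mul (fun u hu => ?_) hm.continuousOn
    exact (Real.continuousAt_rpow_const _ _ (Or.inl (hpos₁ u hu).ne')).continuousWithinAt
  obtain ⟨v, hv, hvmax⟩ := isCompact_Icc.exists_isMaxOn (nonempty_Icc.2 hs₁.le) hcont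
  have hv0 := hpos₁ v hv
  have hkv : 0 < kvKernel α lam v :=
    (hkpos s₁ (hpos₁ s₁ (left_mem_Icc.2 hs₁.le)) hs₁).trans_le (hvmax (left_mem_Icc.2 hs₁.le))
  have hvs₀ : v < s₀ := lt_of_le_of_ne hv.2 fun h => by
    rw [h] at hkv
    exact hk₀.not_gt hkv
  have hgap := (hsub ⟨hls₁.trans_le hv.1, hv.2.trans_lt hlr.2⟩).1
  have hInt := intervalIntegrable_abel_kvKernel lam hα hs₀pos
  have hInt₁ : IntervalIntegrable (fun u => (s₀ - u) ^ (α - 1) * kvKernel α lam u) volume 0 v :=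
    hInt.mono_set (by rw [uIcc_of_le hv0.le, uIcc_of_le hs₀pos.le]; exact Icc_subset_Icc_right hv.2)
  have hInt₂ : IntervalIntegrable (fun u => (s₀ - u) ^ (α - 1) * kvKernel α lam u) volume v s₀ :=
    hInt.mono_set (by rw [uIcc_of_le hv.2, uIcc_of_le hs₀pos.le]; exact Icc_subset_Icc_left hv0.le)
  have hfirst : ∫ u in (0 : ℝ)..v, (s₀ - u) ^ (α - 1) * kvKernel α lam u ≤
      (s₀ / v) ^ (α - 1) * ∫ u in (0 : ℝ)..v, (v - u) ^ (α - 1) * kvKernel α lam u := by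
    rw [← intervalIntegral.integral_const_mul]
    refine intervalIntegral.integral_mono_on_of_le_Ioo hv0.le hInt₁
      ((intervalIntegrable_abel_kvKernel lam hα hv0).const_mul _) fun u hu => ?_
    have hvu : 0 < v - u := sub_pos.2 hu.2
    rw [← mul_assoc, ← Real.mul_rpow (by positivity) hvu.le]
    refine mul_le_mul_of_nonneg_right ?_ (hkpos u hu.1 (hu.2.trans hvs₀)).le
    refine Real.rpow_le_rpow_of_nonpos (by positivity) ?_ (by linarith)
    rw [div_mul_eq_mul_div, div_le_iff₀ hv0]
    nlinarith [hu.1]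
  have hsecond : ∫ u in v..s₀, (s₀ - u) ^ (α - 1) * kvKernel α lam u ≤
      kvKernel α lam v * ((s₀ - v) ^ α / α) := by
    have hpow : ∫ u in v..s₀, (s₀ - u) ^ (α - 1) = (s₀ - v) ^ α / α := by
      rw [intervalIntegral.integral_comp_sub_left (fun u => u ^ (α - 1)) s₀, sub_self,
        integral_rpow (Or.inl (by linarith)), sub_add_cancel, Real.zero_rpow hα.ne', sub_zero]
    have hpowint : IntervalIntegrable (fun u => (s₀ - u) ^ (α - 1)) volume v s₀ := by
      by_contra h
      rw [intervalIntegral.integral_undef h] at hpow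
      have : 0 < s₀ - v := sub_pos.2 hvs₀
      exact (show 0 < (s₀ - v) ^ α / α by positivity).ne hpow
    rw [← hpow, ← intervalIntegral.integral_const_mul]
    refine intervalIntegral.integral_mono_on hv.2 hInt₂ (hpowint.const_mul _) fun u hu => ?_
    rw [mul_comm]
    exact mul_le_mul_of_nonneg_right (hvmax ⟨hv.1.trans hu.1, hu.2⟩)
      (Real.rpow_nonneg (sub_nonneg.2 hu.2) _)
  have hV₀ := kvKernel_volterra hα hlam hs₀pos
  have hVv := kvKernel_volterra hα hlam hv0
  rw [← intervalIntegral.integral_add_adjacent_intervals hInt₁ hInt₂] at hV₀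
  have hdiv : (s₀ / v) ^ (α - 1) * v ^ (α - 1) = s₀ ^ (α - 1) := by
    rw [← Real.mul_rpow (by positivity) hv0.le, div_mul_cancel₀ _ hv0.ne']
  have h1 := mul_le_mul_of_nonneg_left hfirst hlam.le
  have h2 := mul_le_mul_of_nonneg_left hsecond hlam.le
  rw [mul_left_comm, hVv, mul_sub, hdiv] at h1
  have h3 := mul_pos hkv hgap
  have h4 : Real.Gamma α * kvKernel α lam s₀ ≤ 0 := mul_nonpos_of_nonneg_of_nonpos hΓ.le hk₀
  nlinarith

lemma integrableOn_kvKernel {α lam : ℝ} (hα : 0 < α) (hα1 : α < 1) (hlam : 0 < lam) :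
    IntegrableOn (kvKernel α lam) (Ioi 0) := by
  refine integrableOn_Ioi_of_intervalIntegral_norm_bounded lam⁻¹ 0
    (fun s => (intervalIntegrable_kvKernel lam hα 0 s).1) tendsto_id ?_
  filter_upwards [eventually_gt_atTop 0] with s hs
  have hV := kvKernel_volterra hα hlam hs
  have hle : s ^ (α - 1) * ∫ u in (0 : ℝ)..s, ‖kvKernel α lam u‖ ≤
      ∫ u in (0 : ℝ)..s, (s - u) ^ (α - 1) * kvKernel α lam u := by
    rw [← intervalIntegral.integral_const_mul]
    refine intervalIntegral.integral_mono_on_of_le_Ioo hs.le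
      ((intervalIntegrable_kvKernel lam hα 0 s).norm.const_mul _)
      (intervalIntegrable_abel_kvKernel lam hα hs) fun u hu => ?_
    have hk := (kvKernel_pos hα hα1 hlam hu.1).le
    rw [Real.norm_of_nonneg hk]
    exact mul_le_mul_of_nonneg_right (Real.rpow_le_rpow_of_nonpos (sub_pos.2 hu.2)
      (by linarith [hu.1]) (by linarith)) hk
  have hk := mul_pos (Real.Gamma_pos_of_pos hα) (kvKernel_pos hα hα1 hlam hs)
  have hp : 0 < s ^ (α - 1) := Real.rpow_pos_of_pos hs _
  rw [← one_div, le_div_iff₀ hlam]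
  have := mul_le_mul_of_nonneg_left hle hlam.le
  refine le_of_mul_le_mul_left ?_ hp
  nlinarith

lemma measurable_kvKernel {α : ℝ} (lam : ℝ) (hα : 0 < α) : Measurable (kvKernel α lam) :=
  (measurable_id.pow_const _).mul (continuous_mlE_rpow lam hα).measurable

lemma laplace_kvKernel {α lam p : ℝ} (hα : 0 < α) (hα1 : α < 1) (hlam : 0 < lam) (hp : 0 < p) :
    (p ^ α + lam) * ∫ t in Ioi (0 : ℝ), kvKernel α lam t * Real.exp (-(p * t)) = 1 := by
  have hΓ := Real.Gamma_pos_of_pos hα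
  have hpow := Real.integral_rpow_mul_exp_neg_mul_Ioi hα hp
  have hpα : 0 < p ^ α := Real.rpow_pos_of_pos hp _
  have hpowint : IntegrableOn (fun t : ℝ => t ^ (α - 1) * Real.exp (-(p * t))) (Ioi 0) := by
    by_contra h
    rw [integral_undef h] at hpow
    exact (show 0 < (1 / p) ^ α * Real.Gamma α by positivity).ne hpow
  have hkint : IntegrableOn (fun t => kvKernel α lam t * Real.exp (-(p * t))) (Ioi 0) := by
    refine (integrableOn_kvKernel hα hα1 hlam).mul_bdd (c := 1) (by fun_prop) ?_
    filter_upwards [ae_restrict_mem measurableSet_Ioi] with t ht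
    rw [Real.norm_of_nonneg (Real.exp_pos _).le, Real.exp_le_one_iff]
    have : 0 < p * t := mul_pos hp ht
    linarith
  have hconv := integral_posConvolution hkint hpowint (ContinuousLinearMap.mul ℝ ℝ)
  simp only [ContinuousLinearMap.mul_apply'] at hconv
  rw [hpow] at hconv
  have hleft : ∫ x in Ioi (0 : ℝ), ∫ t in (0 : ℝ)..x, kvKernel α lam t * Real.exp (-(p * t)) *
      ((x - t) ^ (α - 1) * Real.exp (-(p * (x - t)))) =
      ∫ x in Ioi (0 : ℝ), lam⁻¹ * (x ^ (α - 1) * Real.exp (-(p * x)) -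
        Real.Gamma α * (kvKernel α lam x * Real.exp (-(p * x)))) := by
    refine setIntegral_congr_fun measurableSet_Ioi fun x hx => ?_
    have hV := kvKernel_volterra hα hlam (show 0 < x from hx)
    have hexp : ∀ t : ℝ, kvKernel α lam t * Real.exp (-(p * t)) *
        ((x - t) ^ (α - 1) * Real.exp (-(p * (x - t)))) =
        Real.exp (-(p * x)) * ((x - t) ^ (α - 1) * kvKernel α lam t) := fun t => by
      rw [show -(p * x) = -(p * t) + -(p * (x - t)) by ring, Real.exp_add]
      ring
    simp only [hexp]
    rw [intervalIntegral.integral_const_mul, eq_inv_mul_iff_mul_eq₀ hlam.ne', mul_left_comm, hV]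
    ring
  rw [hleft, integral_const_mul, integral_sub hpowint (hkint.const_mul _), integral_const_mul,
    hpow, Real.div_rpow zero_le_one hp.le, Real.one_rpow] at hconv
  set L := ∫ t in Ioi (0 : ℝ), kvKernel α lam t * Real.exp (-(p * t))
  field_simp at hconv
  linarith

lemma integral_withDensity_kvKernel {α lam : ℝ} (hα : 0 < α) (hα1 : α < 1) (hlam : 0 < lam)
    (g : ℝ → ℂ) :
    ∫ t, g t ∂(volume.restrict (Ioi 0)).withDensity (fun t => ENNReal.ofReal (kvKernel α lam t)) =
      ∫ t in Ioi (0 : ℝ), (kvKernel α lam t : ℂ) * g t := by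
  rw [integral_withDensity_eq_integral_toReal_smul
    (measurable_kvKernel lam hα).ennreal_ofReal (by simp)]
  refine setIntegral_congr_fun measurableSet_Ioi fun t ht => ?_
  simp only [ENNReal.toReal_ofReal (kvKernel_pos hα hα1 hlam ht).le, Complex.real_smul]

lemma complex_laplace_kvKernel {α lam : ℝ} (hα : 0 < α) (hα1 : α < 1) (hlam : 0 < lam) {p : ℂ}
    (hp : 0 < p.re) :
    (p ^ (α : ℂ) + lam) *
      ∫ t in Ioi (0 : ℝ), (kvKernel α lam t : ℂ) * Complex.exp (-(p * t)) = 1 := by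
  set μ := (volume.restrict (Ioi 0)).withDensity (fun t => ENNReal.ofReal (kvKernel α lam t))
    with hμ
  have hmgf : ∀ z : ℂ, ProbabilityTheory.complexMGF id μ (-z) =
      ∫ t in Ioi (0 : ℝ), (kvKernel α lam t : ℂ) * Complex.exp (-(z * t)) := fun z => by
    rw [ProbabilityTheory.complexMGF, hμ, integral_withDensity_kvKernel hα hα1 hlam]
    simp
  have hset : Iio 0 ⊆ interior (ProbabilityTheory.integrableExpSet id μ) := by
    refine interior_maximal (fun x hx => ?_) isOpen_Iio
    change Integrable (fun t : ℝ => Real.exp (x * id t)) μ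
    rw [hμ, integrable_withDensity_iff_integrable_smul'
      (measurable_kvKernel lam hα).ennreal_ofReal (by simp)]
    have h := (integrableOn_kvKernel hα hα1 hlam).mul_bdd (c := 1)
      (g := fun t => Real.exp (x * id t)) (by fun_prop) (by
        filter_upwards [ae_restrict_mem measurableSet_Ioi] with t ht
        rw [Real.norm_of_nonneg (Real.exp_pos _).le, Real.exp_le_one_iff]
        exact mul_nonpos_of_nonpos_of_nonneg (le_of_lt hx) (le_of_lt ht))
    refine IntegrableOn.congr_fun h (fun t ht => ?_) measurableSet_Ioi
    simp only [ENNReal.toReal_ofReal (kvKernel_pos hα hα1 hlam ht).le, smul_eq_mul]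
  have hU : IsPreconnected {z : ℂ | 0 < z.re} := (convex_halfSpace_re_gt 0).isPreconnected
  have han : AnalyticOnNhd ℂ (fun z : ℂ => (z ^ (α : ℂ) + lam) *
      ProbabilityTheory.complexMGF id μ (-z)) {z : ℂ | 0 < z.re} := by
    intro z hz
    have hz' : z ∈ Complex.slitPlane := Or.inl hz
    refine ((analyticAt_id.cpow analyticAt_const hz').add analyticAt_const).mul ?_
    refine AnalyticAt.fun_comp (ProbabilityTheory.analyticOnNhd_complexMGF (-z) (hset ?_))
      analyticAt_id.neg
    simpa using hz
  have hfreq : ∃ᶠ z in 𝓝[≠] (1 : ℂ), (z ^ (α : ℂ) + lam) *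
      ProbabilityTheory.complexMGF id μ (-z) = 1 := by
    have ht : Tendsto (fun x : ℝ => (x : ℂ)) (𝓝[≠] 1) (𝓝[≠] 1) := by
      refine tendsto_nhdsWithin_of_tendsto_nhds_of_eventually_within _
        (Complex.continuous_ofReal.tendsto' 1 1 (by simp) |>.mono_left nhdsWithin_le_nhds) ?_
      filter_upwards [self_mem_nhdsWithin] with x hx
      simpa using hx
    refine ht.frequently (Eventually.frequently ?_)
    filter_upwards [nhdsWithin_le_nhds (lt_mem_nhds zero_lt_one)] with x hx
    have h := laplace_kvKernel hα hα1 hlam hx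
    have h2 : ∫ t in Ioi (0 : ℝ), (kvKernel α lam t : ℂ) * Complex.exp (-(x * t)) =
        ((∫ t in Ioi (0 : ℝ), kvKernel α lam t * Real.exp (-(x * t)) : ℝ) : ℂ) := by
      rw [← integral_complex_ofReal]
      push_cast
      rfl
    rw [hmgf, h2, ← Complex.ofReal_cpow hx.le]
    exact_mod_cast h
  have h := han.eqOn_of_preconnected_of_frequently_eq analyticOnNhd_const hU
    (show (0 : ℝ) < (1 : ℂ).re by simp) hfreq hp
  simpa only [hmgf] using h

lemma fourier_kvKernel {α lam : ℝ} (hα : 0 < α) (hα1 : α < 1) (hlam : 0 < lam) (ξ : ℝ) :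
    ((Complex.I * ξ) ^ (α : ℂ) + lam) *
      ∫ t in Ioi (0 : ℝ), (kvKernel α lam t : ℂ) * Complex.exp (-(Complex.I * ξ * t)) = 1 := by
  have hk := integrableOn_kvKernel hα hα1 hlam
  have hp : Tendsto (fun ε : ℝ => (ε : ℂ) + Complex.I * ξ) (𝓝[>] 0) (𝓝 (Complex.I * ξ)) := by
    have : Continuous fun ε : ℝ => (ε : ℂ) + Complex.I * ξ := by fun_prop
    exact (this.tendsto' 0 _ (by simp)).mono_left nhdsWithin_le_nhds
  have hpow : Tendsto (fun ε : ℝ => ((ε : ℂ) + Complex.I * ξ) ^ (α : ℂ) + lam) (𝓝[>] 0)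
      (𝓝 ((Complex.I * ξ) ^ (α : ℂ) + lam)) :=
    (((Complex.continuousAt_cpow_const_of_re_pos (Or.inl (by simp)) (by simpa using hα)).tendsto).comp
      hp).add_const _
  have hInt : Tendsto (fun ε : ℝ => ∫ t in Ioi (0 : ℝ), (kvKernel α lam t : ℂ) *
        Complex.exp (-(((ε : ℂ) + Complex.I * ξ) * t))) (𝓝[>] 0)
      (𝓝 (∫ t in Ioi (0 : ℝ), (kvKernel α lam t : ℂ) * Complex.exp (-(Complex.I * ξ * t)))) := by
    refine tendsto_integral_filter_of_dominated_convergence (fun t => ‖kvKernel α lam t‖)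
      (Eventually.of_forall fun ε => ?_) ?_ hk.norm (Eventually.of_forall fun t => ?_)
    · exact (hk.ofReal.aestronglyMeasurable).mul (by fun_prop)
    · filter_upwards [self_mem_nhdsWithin] with ε hε
      filter_upwards [ae_restrict_mem measurableSet_Ioi] with t ht
      rw [norm_mul, Complex.norm_real, Complex.norm_exp]
      refine mul_le_of_le_one_right (norm_nonneg _) (Real.exp_le_one_iff.2 ?_)
      have : 0 < ε * t := mul_pos hε ht
      simp
      linarith
    · have : Continuous fun z : ℂ => (kvKernel α lam t : ℂ) * Complex.exp (-(z * t)) := by fun_prop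
      exact (this.tendsto _).comp hp
  refine tendsto_nhds_unique ((hpow.mul hInt).congr' ?_) tendsto_const_nhds
  filter_upwards [self_mem_nhdsWithin] with ε hε
  exact complex_laplace_kvKernel hα hα1 hlam (by simpa using hε)

section ChangeOfVariables

variable {ψ ψ' : ℝ → ℝ}

lemma integrable_deriv_mul_comp_iff (hψmono : StrictMono ψ) (hψsurj : Function.Surjective ψ)
    (hψderiv : ∀ t, HasDerivAt ψ (ψ' t) t) (hψ'pos : ∀ t, 0 < ψ' t) (G : ℝ → ℂ) :
    Integrable (fun t => (ψ' t : ℂ) * G (ψ t)) ↔ Integrable G := by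
  have h := integrableOn_image_iff_integrableOn_abs_deriv_smul MeasurableSet.univ
    (fun x _ => (hψderiv x).hasDerivWithinAt) hψmono.injective.injOn G
  simpa only [image_univ, hψsurj.range_eq, integrableOn_univ, abs_of_pos (hψ'pos _),
    Complex.real_smul, iff_comm] using h

lemma integral_deriv_mul_comp (hψmono : StrictMono ψ) (hψsurj : Function.Surjective ψ)
    (hψderiv : ∀ t, HasDerivAt ψ (ψ' t) t) (hψ'pos : ∀ t, 0 < ψ' t) (G : ℝ → ℂ) :
    ∫ t, (ψ' t : ℂ) * G (ψ t) = ∫ x, G x := by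
  have h := integral_image_eq_integral_abs_deriv_smul MeasurableSet.univ
    (fun x _ => (hψderiv x).hasDerivWithinAt) hψmono.injective.injOn G
  simpa only [image_univ, hψsurj.range_eq, setIntegral_univ, abs_of_pos (hψ'pos _),
    Complex.real_smul] using h.symm

lemma integrable_prod_deriv_mul_comp_sub (hψmono : StrictMono ψ)
    (hψsurj : Function.Surjective ψ) (hψderiv : ∀ t, HasDerivAt ψ (ψ' t) t)
    (hψ'cont : Continuous ψ') (hψ'pos : ∀ t, 0 < ψ' t) {K F : ℝ → ℂ} (hKm : Measurable K)
    (hK : Integrable K) (hF : Integrable F) :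
    Integrable (fun z : ℝ × ℝ => (ψ' z.1 : ℂ) * K (ψ z.1 - ψ z.2) * F z.2) := by
  have hψm : Measurable ψ := hψmono.monotone.measurable
  have hmeas : AEStronglyMeasurable
      (fun z : ℝ × ℝ => (ψ' z.1 : ℂ) * K (ψ z.1 - ψ z.2) * F z.2) (volume.prod volume) := by
    refine AEStronglyMeasurable.mul (Measurable.aestronglyMeasurable ?_)
      hF.aestronglyMeasurable.comp_snd
    exact (Complex.measurable_ofReal.comp (hψ'cont.measurable.comp measurable_fst)).mul
      (hKm.comp ((hψm.comp measurable_fst).sub (hψm.comp measurable_snd)))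
  refine (integrable_prod_iff' hmeas).2 ⟨Eventually.of_forall fun τ => ?_, ?_⟩
  · exact ((integrable_deriv_mul_comp_iff hψmono hψsurj hψderiv hψ'pos
      (fun x => K (x - ψ τ))).2 (hK.comp_sub_right _)).mul_const (F τ)
  · have h : ∀ τ, ∫ t, ‖(ψ' t : ℂ) * K (ψ t - ψ τ) * F τ‖ = (∫ x, ‖K x‖) * ‖F τ‖ := fun τ => by
      have h1 := integral_deriv_mul_comp hψmono hψsurj hψderiv hψ'pos
        (fun x => ((‖K (x - ψ τ)‖ : ℝ) : ℂ))
      simp only [← Complex.ofReal_mul] at h1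
      rw [integral_complex_ofReal, integral_complex_ofReal, Complex.ofReal_inj,
        integral_sub_right_eq_self (fun x => ‖K x‖)] at h1
      simp only [norm_mul, Complex.norm_real, Real.norm_of_nonneg (hψ'pos _).le]
      rw [integral_mul_const, h1]
    simp only [h]
    exact hF.norm.const_mul _

/-- The convolution theorem for the weighted Fourier transform. -/
lemma integral_deriv_mul_comp_sub_fourier (hψmono : StrictMono ψ)
    (hψsurj : Function.Surjective ψ) (hψderiv : ∀ t, HasDerivAt ψ (ψ' t) t)
    (hψ'cont : Continuous ψ') (hψ'pos : ∀ t, 0 < ψ' t) {K F : ℝ → ℂ} (hKm : Measurable K)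
    (hK : Integrable K) (hF : Integrable F) (ξ : ℝ) :
    ∫ t, (∫ τ, (ψ' t : ℂ) * K (ψ t - ψ τ) * F τ) * Complex.exp (-(Complex.I * ξ * ψ t)) =
      (∫ s, K s * Complex.exp (-(Complex.I * ξ * s))) *
        ∫ τ, F τ * Complex.exp (-(Complex.I * ξ * ψ τ)) := by
  have hψm : Measurable ψ := hψmono.monotone.measurable
  have hInt := integrable_prod_deriv_mul_comp_sub hψmono hψsurj hψderiv hψ'cont hψ'pos hKm hK hF
  have hexp : Integrable (fun z : ℝ × ℝ => (ψ' z.1 : ℂ) * K (ψ z.1 - ψ z.2) * F z.2 *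
      Complex.exp (-(Complex.I * ξ * ψ z.1))) := by
    refine hInt.mul_bdd (c := 1) (Measurable.aestronglyMeasurable ?_) (Eventually.of_forall fun z => ?_)
    · exact Complex.measurable_exp.comp ((Complex.measurable_ofReal.comp
        (hψm.comp measurable_fst)).const_mul _).neg
    · rw [Complex.norm_exp]
      simp
  have hpull : ∀ t, (∫ τ, (ψ' t : ℂ) * K (ψ t - ψ τ) * F τ) *
      Complex.exp (-(Complex.I * ξ * ψ t)) = ∫ τ, (ψ' t : ℂ) * K (ψ t - ψ τ) * F τ *
        Complex.exp (-(Complex.I * ξ * ψ t)) := fun t => (integral_mul_const _ _).symm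
  simp only [hpull]
  rw [integral_integral_swap hexp, ← integral_const_mul]
  refine integral_congr_ae (Eventually.of_forall fun τ => ?_)
  have h1 := integral_deriv_mul_comp hψmono hψsurj hψderiv hψ'pos
    (fun x => K (x - ψ τ) * Complex.exp (-(Complex.I * ξ * ((x - ψ τ : ℝ) : ℂ))))
  rw [integral_sub_right_eq_self (fun x : ℝ => K x * Complex.exp (-(Complex.I * ξ * (x : ℂ))))] at h1
  beta_reduce
  rw [← h1, ← integral_mul_const]
  refine integral_congr_ae (Eventually.of_forall fun t => ?_)
  have h2 : Complex.exp (-(Complex.I * ξ * ψ t)) =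
      Complex.exp (-(Complex.I * ξ * ((ψ t - ψ τ : ℝ) : ℂ))) *
        Complex.exp (-(Complex.I * ξ * ψ τ)) := by
    rw [← Complex.exp_add]
    congr 1
    push_cast
    ring
  beta_reduce
  rw [h2]
  ring

end ChangeOfVariables

lemma mul_sigmaSol_eq {ψ ψ' ω : ℝ → ℝ} (hψmono : StrictMono ψ) (hωpos : ∀ t, 0 < ω t)
    (α lam : ℝ) (f : ℝ → ℂ) (t : ℝ) :
    ((ω t * ψ' t : ℝ) : ℂ) * sigmaSol α lam ψ ψ' ω f t =
      ∫ τ, (ψ' t : ℂ) * (Ioi 0).indicator (fun s => (kvKernel α lam s : ℂ)) (ψ t - ψ τ) *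
        (((ω τ * ψ' τ : ℝ) : ℂ) * f τ) := by
  have hω : (ω t : ℂ) ≠ 0 := Complex.ofReal_ne_zero.2 (hωpos t).ne'
  rw [sigmaSol, Complex.ofReal_mul, mul_comm (ω t : ℂ), mul_assoc, mul_inv_cancel_left₀ hω,
    ← integral_const_mul, ← integral_indicator measurableSet_Iio]
  refine integral_congr_ae (Eventually.of_forall fun τ => ?_)
  beta_reduce
  by_cases h : τ < t
  · rw [indicator_of_mem (show τ ∈ Iio t from h),
      indicator_of_mem (show ψ t - ψ τ ∈ Ioi 0 from sub_pos.2 (hψmono h)), kvKernel]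
    push_cast
    ring
  · rw [indicator_of_notMem (show τ ∉ Iio t from h), indicator_of_notMem, mul_zero, zero_mul]
    exact fun h' => h (hψmono.lt_iff_lt.1 (sub_pos.1 h'))

theorem stmt_15
    (ψ ψ' ω : ℝ → ℝ)
    (hψmono : StrictMono ψ)
    (hψderiv : ∀ t, HasDerivAt ψ (ψ' t) t)
    (hψ'cont : Continuous ψ')
    (hψ'pos : ∀ t, 0 < ψ' t)
    (hψtop : Tendsto ψ atTop atTop)
    (hψbot : Tendsto ψ atBot atBot)
    (hωmeas : Measurable ω)
    (hωpos : ∀ t, 0 < ω t)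
    (hωloc : ∀ K : Set ℝ, IsCompact K → ∃ C > 0, ∀ t ∈ K, ω t ≤ C ∧ C⁻¹ ≤ ω t)
    (α lam : ℝ) (hα : 0 < α) (hα1 : α < 1) (hlam : 0 < lam)
    (f : ℝ → ℂ)
    (hf : Integrable (fun t : ℝ => ((ω t * ψ' t : ℝ) : ℂ) * f t)) :
    -- σ belongs to L¹_{ψ,ω}
    Integrable (fun t : ℝ => ((ω t * ψ' t : ℝ) : ℂ) * sigmaSol α lam ψ ψ' ω f t) ∧
    -- and solves the Kelvin–Voigt equation in the frequency domain
    (∀ ξ : ℝ,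
      wFT ψ ψ' ω (sigmaSol α lam ψ ψ' ω f) ξ =
        wFT ψ ψ' ω f ξ / ((Complex.I * (ξ : ℂ)) ^ (α : ℂ) + (lam : ℂ))) := by
  have hψsurj : Function.Surjective ψ :=
    (continuous_iff_continuousAt.2 fun t => (hψderiv t).continuousAt).surjective hψtop hψbot
  set K : ℝ → ℂ := (Ioi 0).indicator fun s => (kvKernel α lam s : ℂ) with hKdef
  have hKm : Measurable K :=
    (Complex.measurable_ofReal.comp (measurable_kvKernel lam hα)).indicator measurableSet_Ioi
  have hK : Integrable K :=
    (integrable_indicator_iff measurableSet_Ioi).2 (integrableOn_kvKernel hα hα1 hlam).ofReal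
  refine ⟨?_, fun ξ => ?_⟩
  · simp only [mul_sigmaSol_eq hψmono hωpos]
    exact (integrable_prod_deriv_mul_comp_sub hψmono hψsurj hψderiv hψ'cont hψ'pos hKm hK
      hf).integral_prod_left
  · have hKξ : ((Complex.I * ξ) ^ (α : ℂ) + lam) *
        ∫ s, K s * Complex.exp (-(Complex.I * ξ * s)) = 1 := by
      rw [← fourier_kvKernel hα hα1 hlam ξ, ← integral_indicator measurableSet_Ioi]
      simp only [hKdef, indicator_mul_left]
    have hconv := integral_deriv_mul_comp_sub_fourier hψmono hψsurj hψderiv hψ'cont hψ'pos hKm hK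
      hf ξ
    simp only [hKdef, ← mul_sigmaSol_eq hψmono hωpos] at hconv
    rw [← hKdef] at hconv
    rw [eq_div_iff (left_ne_zero_of_mul_eq_one hKξ), wFT, wFT]
    simp only [mul_comm _ ((ω _ * ψ' _ : ℝ) : ℂ), ← mul_assoc]
    rw [hconv]
    linear_combination (Real.sqrt (2 * Real.pi) : ℂ)⁻¹ *
      (∫ τ, ((ω τ * ψ' τ : ℝ) : ℂ) * f τ * Complex.exp (-(Complex.I * ξ * ψ τ))) * hKξ
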